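/- Assume LICQ holds on S. Then f is coercive on S if and only if f is bounded from below on S and T_∞(f,S) = ∅. -/

import Mathlib

open Filter

noncomputable section

def IsPolyFun {n : ℕ} (f : EuclideanSpace ℝ (Fin n) → ℝ) : Prop :=
  ∃ P : MvPolynomial (Fin n) ℝ, ∀ x, f x = MvPolynomial.eval (fun i => x i) P

def conSet {n l m : ℕ} (g : Fin l → EuclideanSpace ℝ (Fin n) → ℝ)
    (h : Fin m → EuclideanSpace ℝ (Fin n) → ℝ) : Set (EuclideanSpace ℝ (Fin n)) :=
  {x | (∀ i, g i x = 0) ∧ (∀ j, 0 ≤ h j x)}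

def LICQ {n l m : ℕ} (g : Fin l → EuclideanSpace ℝ (Fin n) → ℝ)
    (h : Fin m → EuclideanSpace ℝ (Fin n) → ℝ) : Prop :=
  ∀ x ∈ conSet g h, LinearIndependent ℝ
    (Sum.elim (fun i : Fin l => gradient (g i) x)
      (fun j : {j : Fin m // h j x = 0} => gradient (h j.1) x))

def criticalSet {n l m : ℕ} (f : EuclideanSpace ℝ (Fin n) → ℝ)
    (g : Fin l → EuclideanSpace ℝ (Fin n) → ℝ)
    (h : Fin m → EuclideanSpace ℝ (Fin n) → ℝ) : Set (EuclideanSpace ℝ (Fin n)) :=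
  {x | x ∈ conSet g h ∧ ∃ (lam : Fin l → ℝ) (nu : Fin m → ℝ),
    gradient f x - ∑ i, lam i • gradient (g i) x - ∑ j, nu j • gradient (h j) x = 0 ∧
    ∀ j, nu j * h j x = 0}

def tangencySet {n l m : ℕ} (f : EuclideanSpace ℝ (Fin n) → ℝ)
    (g : Fin l → EuclideanSpace ℝ (Fin n) → ℝ)
    (h : Fin m → EuclideanSpace ℝ (Fin n) → ℝ) : Set (EuclideanSpace ℝ (Fin n)) :=
  {x | x ∈ conSet g h ∧ ∃ (κ : ℝ) (lam : Fin l → ℝ) (nu : Fin m → ℝ) (μ : ℝ),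
    (κ, lam, nu, μ) ≠ 0 ∧
    κ • gradient f x - ∑ i, lam i • gradient (g i) x - ∑ j, nu j • gradient (h j) x - μ • x = 0 ∧
    ∀ j, nu j * h j x = 0}

def tangencyValues {n l m : ℕ} (f : EuclideanSpace ℝ (Fin n) → ℝ)
    (g : Fin l → EuclideanSpace ℝ (Fin n) → ℝ)
    (h : Fin m → EuclideanSpace ℝ (Fin n) → ℝ) : Set ℝ :=
  {lam | ∃ x : ℕ → EuclideanSpace ℝ (Fin n), (∀ k, x k ∈ tangencySet f g h) ∧
    Tendsto (fun k => ‖x k‖) atTop atTop ∧ Tendsto (fun k => f (x k)) atTop (nhds lam)}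

def psi {n l m : ℕ} (f : EuclideanSpace ℝ (Fin n) → ℝ)
    (g : Fin l → EuclideanSpace ℝ (Fin n) → ℝ)
    (h : Fin m → EuclideanSpace ℝ (Fin n) → ℝ) (t : ℝ) : EReal :=
  sInf ((fun x => (f x : EReal)) '' {x | x ∈ conSet g h ∧ ‖x‖ = t})

def CoerciveOn {n : ℕ} (f : EuclideanSpace ℝ (Fin n) → ℝ)
    (S : Set (EuclideanSpace ℝ (Fin n))) : Prop :=
  ∀ x : ℕ → EuclideanSpace ℝ (Fin n), (∀ k, x k ∈ S) →
    Tendsto (fun k => ‖x k‖) atTop atTop → Tendsto (fun k => f (x k)) atTop atTop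

theorem IsPolyFun.contDiff {n : ℕ} {f : EuclideanSpace ℝ (Fin n) → ℝ} (hf : IsPolyFun f) :
    ContDiff ℝ 1 f := by
  obtain ⟨P, hP⟩ := hf
  rw [funext hP]
  clear hP
  induction P using MvPolynomial.induction_on with
  | C a => simpa using contDiff_const
  | add p q hp hq => simpa using hp.add hq
  | mul_X p i hp =>
    have hi : ContDiff ℝ 1 fun x : EuclideanSpace ℝ (Fin n) => x i := by fun_prop
    simpa using hp.mul hi

theorem IsPolyFun.continuous {n : ℕ} {f : EuclideanSpace ℝ (Fin n) → ℝ} (hf : IsPolyFun f) :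
    Continuous f :=
  hf.contDiff.continuous

theorem IsPolyFun.hasStrictFDerivAt {n : ℕ} {f : EuclideanSpace ℝ (Fin n) → ℝ}
    (hf : IsPolyFun f) (x : EuclideanSpace ℝ (Fin n)) :
    HasStrictFDerivAt f (InnerProductSpace.toDual ℝ _ (gradient f x)) x := by
  simpa [gradient] using hf.contDiff.contDiffAt.hasStrictFDerivAt one_ne_zero

theorem isClosed_conSet {n l m : ℕ} {g : Fin l → EuclideanSpace ℝ (Fin n) → ℝ}
    {h : Fin m → EuclideanSpace ℝ (Fin n) → ℝ} (hg : ∀ i, Continuous (g i))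
    (hh : ∀ j, Continuous (h j)) : IsClosed (conSet g h) := by
  simp only [conSet, Set.ofPred_and, Set.ofPred_forall]
  exact (isClosed_iInter fun i => isClosed_eq (hg i) continuous_const).inter
    (isClosed_iInter fun j => isClosed_le continuous_const (hh j))

/-- A minimizer of `f` over the part of the constraint set lying on a sphere belongs to the
tangency variety (Fritz John conditions). -/
theorem mem_tangencySet_of_isMinOn_sphere {n l m : ℕ} {f : EuclideanSpace ℝ (Fin n) → ℝ}
    {g : Fin l → EuclideanSpace ℝ (Fin n) → ℝ} {h : Fin m → EuclideanSpace ℝ (Fin n) → ℝ}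
    (hf : IsPolyFun f) (hg : ∀ i, IsPolyFun (g i)) (hh : ∀ j, IsPolyFun (h j))
    {y : EuclideanSpace ℝ (Fin n)} (hy : y ∈ conSet g h)
    (hmin : ∀ x ∈ conSet g h, ‖x‖ = ‖y‖ → f y ≤ f x) : y ∈ tangencySet f g h := by
  classical
  let c : Option (Fin l ⊕ {j : Fin m // h j y = 0}) → EuclideanSpace ℝ (Fin n) → ℝ := fun o =>
    o.elim (fun x => ‖x‖ ^ 2) (Sum.elim g fun j => h j.1)
  let v : Option (Fin l ⊕ {j : Fin m // h j y = 0}) → EuclideanSpace ℝ (Fin n) := fun o =>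
    o.elim ((2 : ℝ) • y) (Sum.elim (fun i => gradient (g i) y) fun j => gradient (h j.1) y)
  have hc : ∀ o, HasStrictFDerivAt (c o) (InnerProductSpace.toDual ℝ _ (v o)) y := by
    rintro (_ | i | j)
    · convert! hasStrictFDerivAt_norm_sq y using 1
      ext x
      simp [v, two_mul]
    · exact (hg i).hasStrictFDerivAt y
    · exact (hh j.1).hasStrictFDerivAt y
  have hext : IsLocalExtrOn f {x | ∀ o, c o x = c o y} y := by
    refine Or.inl ?_
    have hpos : ∀ᶠ x in nhds y, ∀ j, h j y ≠ 0 → 0 < h j x := by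
      refine eventually_all.2 fun j => ?_
      by_cases hj : h j y = 0
      · simp [hj]
      · exact ((hh j).continuous.continuousAt.eventually
          (lt_mem_nhds (lt_of_le_of_ne (hy.2 j) (Ne.symm hj)))).mono fun _ hx _ => hx
    filter_upwards [mem_nhdsWithin_of_mem_nhds hpos, self_mem_nhdsWithin] with x hx hxc
    refine hmin x ⟨fun i => (hxc (some (Sum.inl i))).trans (hy.1 i), fun j => ?_⟩ ?_
    · by_cases hj : h j y = 0
      · exact ((hxc (some (Sum.inr ⟨j, hj⟩))).trans hj).ge
      · exact (hx j hj).le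
    · exact (sq_eq_sq₀ (norm_nonneg _) (norm_nonneg _)).1 (hxc none)
  obtain ⟨Λ, Λ₀, hne, hsum⟩ :=
    hext.exists_multipliers_of_hasStrictFDerivAt hc (hf.hasStrictFDerivAt y)
  have hgrad : ∑ o, Λ o • v o + Λ₀ • gradient f y = 0 := by
    apply (InnerProductSpace.toDual ℝ (EuclideanSpace ℝ (Fin n))).injective
    simpa using hsum
  rw [Fintype.sum_option, Fintype.sum_sum_type] at hgrad
  refine ⟨hy, Λ₀, fun i => -Λ (some (Sum.inl i)),
    fun j => if hj : h j y = 0 then -Λ (some (Sum.inr ⟨j, hj⟩)) else 0, -(2 * Λ none), ?_, ?_, ?_⟩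
  · intro h0
    simp only [Prod.mk_eq_zero, neg_eq_zero, mul_eq_zero, OfNat.ofNat_ne_zero, false_or] at h0
    obtain ⟨h1, h2, h3, h4⟩ := h0
    refine hne (Prod.ext (funext ?_) h1)
    rintro (_ | i | j)
    · exact h4
    · simpa using congrFun h2 i
    · simpa [j.2] using congrFun h3 j.1
  · have hν : ∑ j, (if hj : h j y = 0 then -Λ (some (Sum.inr ⟨j, hj⟩)) else 0) •
        gradient (h j) y =
        -∑ j : {j : Fin m // h j y = 0}, Λ (some (Sum.inr j)) • gradient (h j.1) y := by
      rw [← Finset.sum_neg_distrib, ← Fintype.sum_subtype_add_sum_subtype (fun j => h j y = 0)]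
      refine (congrArg₂ (· + ·) (Finset.sum_congr rfl fun j _ => ?_)
        (Finset.sum_eq_zero fun j _ => ?_)).trans (add_zero _)
      · rw [dif_pos j.2, neg_smul]
      · rw [dif_neg j.2, zero_smul]
    rw [hν]
    simp only [v, Option.elim, Sum.elim_inl, Sum.elim_inr] at hgrad
    rw [← hgrad]
    simp only [neg_smul, Finset.sum_neg_distrib, smul_smul, mul_comm]
    abel
  · intro j
    by_cases hj : h j y = 0 <;> simp [hj]

theorem CoerciveOn.bddBelow_image {n : ℕ} {f : EuclideanSpace ℝ (Fin n) → ℝ}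
    {S : Set (EuclideanSpace ℝ (Fin n))} (hcoer : CoerciveOn f S) (hf : Continuous f) :
    BddBelow (f '' S) := by
  by_contra hb
  have hlow : ∀ k : ℕ, ∃ x ∈ S, ‖x‖ > k ∧ f x < 0 := by
    intro k
    obtain ⟨b, hbk⟩ :=
      (isCompact_closedBall (0 : EuclideanSpace ℝ (Fin n)) k).bddBelow_image hf.continuousOn
    obtain ⟨_, ⟨x, hxS, rfl⟩, hx⟩ := not_bddBelow_iff.1 hb (min b 0)
    refine ⟨x, hxS, ?_, hx.trans_le (min_le_right _ _)⟩
    by_contra! hxk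
    exact absurd (hbk ⟨x, by simpa using hxk, rfl⟩) (hx.trans_le (min_le_left _ _)).not_ge
  choose x hxS hxk hx0 using hlow
  obtain ⟨k, hk⟩ := ((hcoer x hxS (tendsto_atTop_mono (fun k => (hxk k).le)
    tendsto_natCast_atTop_atTop)).eventually_ge_atTop 0).exists
  exact absurd hk (hx0 k).not_ge

theorem CoerciveOn.tangencyValues_eq_empty {n l m : ℕ} {f : EuclideanSpace ℝ (Fin n) → ℝ}
    {g : Fin l → EuclideanSpace ℝ (Fin n) → ℝ} {h : Fin m → EuclideanSpace ℝ (Fin n) → ℝ}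
    (hcoer : CoerciveOn f (conSet g h)) : tangencyValues f g h = ∅ :=
  Set.eq_empty_of_forall_notMem fun _ ⟨x, hx, hx_norm, hx_lim⟩ =>
    not_tendsto_atTop_of_tendsto_nhds hx_lim (hcoer x (fun k => (hx k).1) hx_norm)

/-- If `f` is bounded below but not coercive on the constraint set, then it has a tangency value
at infinity. -/
theorem tangencyValues_nonempty_of_not_coerciveOn {n l m : ℕ}
    {f : EuclideanSpace ℝ (Fin n) → ℝ} {g : Fin l → EuclideanSpace ℝ (Fin n) → ℝ}
    {h : Fin m → EuclideanSpace ℝ (Fin n) → ℝ}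
    (hf : IsPolyFun f) (hg : ∀ i, IsPolyFun (g i)) (hh : ∀ j, IsPolyFun (h j))
    (hbdd : BddBelow (f '' conSet g h)) (hcoer : ¬ CoerciveOn f (conSet g h)) :
    (tangencyValues f g h).Nonempty := by
  simp only [CoerciveOn, not_forall] at hcoer
  obtain ⟨x, hxS, hx_norm, hx_lim⟩ := hcoer
  simp only [tendsto_atTop, not_forall, not_eventually, not_le] at hx_lim
  obtain ⟨M, hM⟩ := hx_lim
  obtain ⟨φ, hφ, hφM⟩ := extraction_of_frequently_atTop hM
  have hclosed := isClosed_conSet (fun i => (hg i).continuous) fun j => (hh j).continuous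
  have hminimizer : ∀ k, ∃ y ∈ conSet g h, ‖y‖ = ‖x (φ k)‖ ∧
      ∀ z ∈ conSet g h, ‖z‖ = ‖x (φ k)‖ → f y ≤ f z := by
    intro k
    obtain ⟨y, ⟨hyS, hyn⟩, hy⟩ :=
      ((isCompact_sphere (0 : EuclideanSpace ℝ (Fin n)) ‖x (φ k)‖).inter_left
        hclosed).exists_isMinOn ⟨x (φ k), hxS _, by simp⟩ hf.continuous.continuousOn
    exact ⟨y, hyS, by simpa using hyn, fun z hzS hz => hy ⟨hzS, by simpa using hz⟩⟩
  choose y hyS hyn hy using hminimizer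
  obtain ⟨b, hb⟩ := hbdd
  obtain ⟨c, -, ψ, hψ, hc⟩ := (isCompact_Icc (a := b) (b := M)).tendsto_subseq
    (x := fun k => f (y k)) fun k =>
      ⟨hb ⟨y k, hyS k, rfl⟩, (hy k _ (hxS _) rfl).trans (hφM k).le⟩
  refine ⟨c, fun k => y (ψ k), fun k => mem_tangencySet_of_isMinOn_sphere hf hg hh (hyS _)
    fun z hzS hz => hy _ z hzS (hz.trans (hyn _)), ?_, hc⟩
  simpa only [hyn] using! hx_norm.comp (hφ.comp hψ).tendsto_atTop

theorem coercive_iff_bddBelow_and_no_tangency_values {n l m : ℕ} (f : EuclideanSpace ℝ (Fin n) → ℝ)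
    (g : Fin l → EuclideanSpace ℝ (Fin n) → ℝ) (h : Fin m → EuclideanSpace ℝ (Fin n) → ℝ)
    (hf : IsPolyFun f) (hg : ∀ i, IsPolyFun (g i)) (hh : ∀ j, IsPolyFun (h j))
    (hS : (conSet g h).Nonempty) (hSu : ¬ Bornology.IsBounded (conSet g h))
    (hlicq : LICQ g h) :
    CoerciveOn f (conSet g h) ↔
      (BddBelow (f '' conSet g h) ∧ tangencyValues f g h = ∅) := by
  refine ⟨fun hcoer => ⟨hcoer.bddBelow_image hf.continuous, hcoer.tangencyValues_eq_empty⟩,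
    fun ⟨hbdd, hempty⟩ => ?_⟩
  by_contra hcoer
  exact (tangencyValues_nonempty_of_not_coerciveOn hf hg hh hbdd hcoer).ne_empty hempty
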